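/- Let Γ be a mixed graph. The TRAAG G_Γ is left-orderable if and only if Γ contains no oriented cycle. -/

import Mathlib

/-- A mixed graph: a simplicial graph (given by a symmetric irreflexive adjacency
relation) together with a set `D` of oriented edges; an oriented edge is recorded as the
ordered pair `(o e, t e)` of its origin and terminus, it must be an edge of the graph,
and an edge carries at most one orientation. -/
structure MixedGraph (V : Type*) where
  /-- adjacency relation: `adj u v` iff `{u,v}` is an edge -/
  adj : V → V → Prop
  symm : ∀ u v, adj u v → adj v u
  loopless : ∀ v, ¬ adj v v
  /-- the set of oriented edges, as ordered pairs (origin, terminus) -/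
  D : Set (V × V)
  D_isEdge : ∀ e ∈ D, adj e.1 e.2
  D_antisymm : ∀ e ∈ D, (e.2, e.1) ∉ D

namespace MixedGraph

variable {V : Type*}

/-- The relators of the twisted right-angled Artin group of a mixed graph: a commutator
`u v u⁻¹ v⁻¹` for each unoriented edge `{u,v}`, and a Klein-bottle relator `a b a⁻¹ b`
for each oriented edge `[a, b⟩`. -/
def traagRels (Γ : MixedGraph V) : Set (FreeGroup V) :=
  {r | (∃ u v : V, Γ.adj u v ∧ (u, v) ∉ Γ.D ∧ (v, u) ∉ Γ.D ∧
          r = FreeGroup.of u * FreeGroup.of v * (FreeGroup.of u)⁻¹ * (FreeGroup.of v)⁻¹) ∨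
       (∃ a b : V, (a, b) ∈ Γ.D ∧
          r = FreeGroup.of a * FreeGroup.of b * (FreeGroup.of a)⁻¹ * FreeGroup.of b)}

/-- The twisted right-angled Artin group (TRAAG) based on a mixed graph `Γ`. -/
def TRAAG (Γ : MixedGraph V) : Type _ := PresentedGroup Γ.traagRels

instance (Γ : MixedGraph V) : Group (TRAAG Γ) := by unfold TRAAG; infer_instance

/-- The generator of the TRAAG corresponding to a vertex. -/
def gen (Γ : MixedGraph V) (v : V) : TRAAG Γ := PresentedGroup.of v

/-- `Γ` has an oriented cycle: a sequence `e₀, …, eₙ` of oriented edges with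
`t(eᵢ) = o(e_{i+1})` cyclically. -/
def HasOrientedCycle (Γ : MixedGraph V) : Prop :=
  ∃ (n : ℕ) (c : ZMod (n + 1) → V × V),
    (∀ i, c i ∈ Γ.D) ∧ ∀ i, (c i).2 = (c (i + 1)).1

/-- The full mixed subgraph of `Γ` spanned by a set `U` of vertices. -/
def induce (Γ : MixedGraph V) (U : Set V) : MixedGraph U where
  adj u v := Γ.adj u v
  symm u v h := Γ.symm u v h
  loopless v := Γ.loopless v
  D := {p | ((p.1 : V), (p.2 : V)) ∈ Γ.D}
  D_isEdge _ he := Γ.D_isEdge _ he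
  D_antisymm _ he := Γ.D_antisymm _ he

/-- A vertex `v` is a source if every edge containing `v` is either unoriented or
oriented with origin `v`, i.e. no oriented edge has terminus `v`. -/
def IsSource (Γ : MixedGraph V) (v : V) : Prop :=
  ∀ u : V, (u, v) ∉ Γ.D

/-- The link of a vertex: its set of neighbours. -/
def lk (Γ : MixedGraph V) (v : V) : Set V := {u | Γ.adj u v}

/-- The star of a vertex: its link together with the vertex itself. -/
def st (Γ : MixedGraph V) (v : V) : Set V := insert v (Γ.lk v)

end MixedGraph

/-- A group is left-orderable if it admits a total order invariant under left
multiplication. -/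
def LeftOrderable (G : Type*) [Group G] : Prop :=
  ∃ r : G → G → Prop, IsStrictTotalOrder G r ∧ ∀ g x y : G, r x y → r (g * x) (g * y)

/-- Every nontrivial subgroup admits a nontrivial homomorphism to `ℤ`. -/
def HereditarilyIndicable (G : Type*) [Group G] : Prop :=
  ∀ H : Subgroup G, H ≠ ⊥ → ∃ f : H →* Multiplicative ℤ, f ≠ 1

namespace LeftOrderable

variable {G : Type*} [Group G]

/-- A positive cone determines a left order. -/
theorem of_cone (P : Set G) (h1 : 1 ∉ P) (hmul : ∀ x ∈ P, ∀ y ∈ P, x * y ∈ P)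
    (htot : ∀ x, x ≠ 1 → x ∈ P ∨ x⁻¹ ∈ P) : LeftOrderable G := by
  refine ⟨fun x y ↦ x⁻¹ * y ∈ P,
    { trichotomous := fun x y hxy hyx ↦ ?_
      irrefl := fun x hx ↦ h1 (by simpa using hx)
      trans := fun x y z hxy hyz ↦ by simpa [mul_assoc] using hmul _ hxy _ hyz },
    fun g x y h ↦ by simpa [mul_assoc] using h⟩
  by_contra hne
  rcases htot (x⁻¹ * y) (fun h ↦ hne (inv_mul_eq_one.1 h)) with h | h
  · exact hxy h
  · exact hyx (by simpa using h)

theorem exists_cone (hG : LeftOrderable G) : ∃ P : Set G, 1 ∉ P ∧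
    (∀ x ∈ P, ∀ y ∈ P, x * y ∈ P) ∧ ∀ x, x ≠ 1 → x ∈ P ∨ x⁻¹ ∈ P := by
  obtain ⟨r, hr, hmul⟩ := hG
  refine ⟨{x | r 1 x}, irrefl_of r 1, fun x hx y hy ↦ ?_, fun x hx ↦ ?_⟩
  · exact trans_of r hx (by simpa using hmul x _ _ hy)
  · by_contra! h
    exact hx (Std.Trichotomous.trichotomous (r := r) x 1
      (fun hlt ↦ h.2 (by simpa using hmul x⁻¹ _ _ hlt)) h.1)

/-- A group is left-orderable if it is approximated along an ultrafilter by left-orderable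
groups. -/
theorem of_ultrafilter {ι F : Type*} [Group F] (U : Ultrafilter ι) {K : ι → Type*}
    [∀ i, Group (K i)] (hK : ∀ i, LeftOrderable (K i)) (f : F →* G)
    (hf : Function.Surjective f) (k : ∀ i, F →* K i)
    (hk : ∀ w, f w = 1 ↔ ∀ᶠ i in (U : Filter ι), k i w = 1) : LeftOrderable G := by
  choose P h1 hmul htot using fun i ↦ (hK i).exists_cone
  refine .of_cone {g | ∃ w, f w = g ∧ ∀ᶠ i in (U : Filter ι), k i w ∈ P i} ?_ ?_ ?_
  · rintro ⟨w, hw, hP⟩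
    obtain ⟨i, hi, hi'⟩ := (((hk w).1 hw).and hP).exists
    exact h1 i (hi ▸ hi')
  · rintro _ ⟨w, rfl, hw⟩ _ ⟨w', rfl, hw'⟩
    refine ⟨w * w', map_mul f w w', ?_⟩
    filter_upwards [hw, hw'] with i hi hi'
    rw [map_mul]
    exact hmul i _ hi _ hi'
  · intro x hx
    obtain ⟨w, rfl⟩ := hf x
    rw [Ne, hk, ← Ultrafilter.eventually_not] at hx
    have : ∀ᶠ i in (U : Filter ι), k i w ∈ P i ∨ k i w⁻¹ ∈ P i := by
      filter_upwards [hx] with i hi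
      rw [map_inv]
      exact htot i _ hi
    exact (Ultrafilter.eventually_or.1 this).imp (fun h ↦ ⟨w, rfl, h⟩)
      (fun h ↦ ⟨w⁻¹, map_inv f w, h⟩)

end LeftOrderable

namespace HereditarilyIndicable

variable {G : Type*} [Group G]

theorem of_subsingleton [Subsingleton G] : HereditarilyIndicable G :=
  fun _ hH ↦ (hH (Subsingleton.elim _ _)).elim

theorem multiplicative_int : HereditarilyIndicable (Multiplicative ℤ) :=
  fun H hH ↦ ⟨H.subtype, fun h ↦ hH (by
    rw [← H.range_subtype, h, MonoidHom.range_one])⟩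

/-- Free groups are hereditarily indicable, by the Nielsen–Schreier theorem. -/
theorem freeGroup (X : Type*) : HereditarilyIndicable (FreeGroup X) := by
  intro H hH
  rcases isEmpty_or_nonempty (IsFreeGroup.Generators H) with hE | ⟨⟨a⟩⟩
  · have : Subsingleton H := (IsFreeGroup.toFreeGroup H).toEquiv.subsingleton
    exact (hH (H.eq_bot_of_subsingleton)).elim
  · refine ⟨IsFreeGroup.lift fun _ ↦ Multiplicative.ofAdd 1, fun h ↦ ?_⟩
    have := DFunLike.congr_fun h (IsFreeGroup.of a)
    rw [IsFreeGroup.lift_of] at this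
    simp at this

/-- An extension of hereditarily indicable groups is hereditarily indicable. -/
theorem of_ker {Q : Type*} [Group Q] (π : G →* Q) (hQ : HereditarilyIndicable Q)
    (hK : HereditarilyIndicable π.ker) : HereditarilyIndicable G := by
  intro H hH
  by_cases hm : H.map π = ⊥
  · have hle : H ≤ π.ker := (Subgroup.map_eq_bot_iff H).1 hm
    obtain ⟨f, hf⟩ := hK (H.subgroupOf π.ker) fun h ↦ hH <| by
      rw [← Subgroup.map_subgroupOf_eq_of_le hle, h, Subgroup.map_bot]
    refine ⟨f.comp (Subgroup.subgroupOfEquivOfLe hle).symm.toMonoidHom, fun h ↦ hf ?_⟩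
    ext x
    simpa using DFunLike.congr_fun h (Subgroup.subgroupOfEquivOfLe hle x)
  · obtain ⟨f, hf⟩ := hQ _ hm
    refine ⟨f.comp (π.subgroupMap H), fun h ↦ hf ?_⟩
    rw [← MonoidHom.cancel_right (π.subgroupMap_surjective H), h, MonoidHom.one_comp]

theorem of_injective {Q : Type*} [Group Q] (π : G →* Q) (hπ : Function.Injective π)
    (hQ : HereditarilyIndicable Q) : HereditarilyIndicable G := by
  have : Subsingleton π.ker := by
    rw [(MonoidHom.ker_eq_bot_iff π).2 hπ]
    infer_instance
  exact of_ker π hQ of_subsingleton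

theorem semidirectProduct {N : Type*} [Group N] (φ : G →* MulAut N)
    (hN : HereditarilyIndicable N) (hG : HereditarilyIndicable G) :
    HereditarilyIndicable (N ⋊[φ] G) := by
  refine of_ker SemidirectProduct.rightHom hG ?_
  rw [← SemidirectProduct.range_inl_eq_ker_rightHom]
  exact of_injective (MonoidHom.ofInjective SemidirectProduct.inl_injective).symm.toMonoidHom
    (MulEquiv.injective _) hN

/-- A version of the Burns–Hale theorem: extend a left-invariant total preorder, given by the set
of elements that are strictly greater than `1`, to a maximal one. -/
theorem leftOrderable (hG : HereditarilyIndicable G) : LeftOrderable G := by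
  let S : Set (Set G) := {P | 1 ∉ P ∧ (∀ x ∈ P, ∀ y ∈ P, x * y ∈ P) ∧
    ∀ x y, x * y ∈ P → x ∈ P ∨ y ∈ P}
  obtain ⟨P, ⟨h1, hmul, hcop⟩, hmax⟩ := zorn_subset S fun c hc hchain ↦ by
    refine ⟨⋃₀ c, ⟨?_, ?_, ?_⟩, fun s hs ↦ Set.subset_sUnion_of_mem hs⟩
    · rintro ⟨s, hs, h⟩
      exact (hc hs).1 h
    · rintro x ⟨s, hs, hx⟩ y ⟨t, ht, hy⟩
      rcases hchain.total hs ht with h | h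
      · exact ⟨t, ht, (hc ht).2.1 _ (h hx) _ hy⟩
      · exact ⟨s, hs, (hc hs).2.1 _ hx _ (h hy)⟩
    · rintro x y ⟨s, hs, h⟩
      exact ((hc hs).2.2 x y h).imp (fun h ↦ ⟨s, hs, h⟩) (fun h ↦ ⟨s, hs, h⟩)
  let H : Subgroup G :=
    { carrier := {x | x ∉ P ∧ x⁻¹ ∉ P}
      one_mem' := by simpa using h1
      mul_mem' := fun {x y} hx hy ↦
        ⟨fun h ↦ (hcop _ _ h).elim hx.1 hy.1, fun h ↦ by
          rw [mul_inv_rev] at h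
          exact (hcop _ _ h).elim hy.2 hx.2⟩
      inv_mem' := fun {x} hx ↦ ⟨hx.2, by simpa using hx.1⟩ }
  have hHP : ∀ x ∈ H, ∀ y ∈ P, x * y ∈ P := fun x hx y hy ↦
    (hcop x⁻¹ (x * y) (by simpa using hy)).resolve_left hx.2
  have hPH : ∀ x ∈ P, ∀ y ∈ H, x * y ∈ P := fun x hx y hy ↦
    (hcop (x * y) y⁻¹ (by simpa using hx)).resolve_right hy.2
  by_cases hH : H = ⊥
  · refine .of_cone P h1 hmul fun x hx ↦ ?_
    by_contra! h
    exact hx ((Subgroup.eq_bot_iff_forall H).1 hH x h)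
  obtain ⟨f, hf⟩ := hG H hH
  obtain ⟨a, ha⟩ : ∃ a : H, 1 < f a := by
    obtain ⟨a, ha⟩ := DFunLike.ne_iff.1 hf
    rcases lt_or_gt_of_ne ha with h | h
    · exact ⟨a⁻¹, by simpa using h⟩
    · exact ⟨a, h⟩
  have hle : P ⊆ P ∪ {x | ∃ hx : x ∈ H, 1 < f ⟨x, hx⟩} := Set.subset_union_left
  refine (a.2.1 (hmax ⟨?_, ?_, ?_⟩ hle (Or.inr ⟨a.2, ha⟩))).elim
  · rintro (h | ⟨h, hf⟩)
    · exact h1 h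
    · exact hf.ne' (map_one f)
  · rintro x (hx | ⟨hx, hfx⟩) y (hy | ⟨hy, hfy⟩)
    · exact Or.inl (hmul x hx y hy)
    · exact Or.inl (hPH x hx y hy)
    · exact Or.inl (hHP x hx y hy)
    · refine Or.inr ⟨H.mul_mem hx hy, ?_⟩
      have : f ⟨x * y, H.mul_mem hx hy⟩ = f ⟨x, hx⟩ * f ⟨y, hy⟩ := map_mul f ⟨x, hx⟩ ⟨y, hy⟩
      rw [this]
      exact one_lt_mul'' hfx hfy
  · rintro x y (h | ⟨h, hf⟩)
    · exact (hcop x y h).imp Or.inl Or.inl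
    · by_cases hx : x ∈ H
      · have hy : y ∈ H := (H.mul_mem_cancel_left hx).1 h
        have : f ⟨x * y, h⟩ = f ⟨x, hx⟩ * f ⟨y, hy⟩ := map_mul f ⟨x, hx⟩ ⟨y, hy⟩
        by_contra! hxy
        refine hf.not_ge (this ▸ mul_le_one' ?_ ?_)
        · exact not_lt.1 fun h' ↦ hxy.1 (Or.inr ⟨hx, h'⟩)
        · exact not_lt.1 fun h' ↦ hxy.2 (Or.inr ⟨hy, h'⟩)
      · by_cases hxP : x ∈ P
        · exact Or.inl (Or.inl hxP)
        · have hx' : x⁻¹ ∈ P := by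
            by_contra h'
            exact hx ⟨hxP, h'⟩
          exact Or.inr (Or.inl (by simpa using hPH _ hx' _ h))

end HereditarilyIndicable

theorem map_mulAut_zpow {A B : Type*} [Group A] [Group B] {f : A →* B} {α : MulAut A}
    {β : MulAut B} (h : ∀ x, f (α x) = β (f x)) (n : ℤ) (x : A) :
    f ((α ^ n) x) = (β ^ n) (f x) := by
  have h_inv : ∀ x, f (α⁻¹ x) = β⁻¹ (f x) := fun x ↦ by
    rw [← MulAut.inv_apply_self _ β (f (α⁻¹ x)), ← h, MulAut.apply_inv_self]
  induction n generalizing x with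
  | zero => simp
  | succ n ih => rw [zpow_add_one, zpow_add_one, MulAut.mul_apply, MulAut.mul_apply, ih, h]
  | pred n ih => rw [zpow_sub_one, zpow_sub_one, MulAut.mul_apply, MulAut.mul_apply, ih, h_inv]

/-- The action of a group `L` on the free group on the set `L` induced by conjugation. -/
def FreeGroup.conjAct (L : Type*) [Group L] : L →* MulAut (FreeGroup L) where
  toFun g := FreeGroup.freeGroupCongr (MulAut.conj g).toEquiv
  map_one' := by ext; simp
  map_mul' g h := by ext; simp [FreeGroup.map.comp]

@[simp]
theorem FreeGroup.conjAct_of {L : Type*} [Group L] (g h : L) :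
    FreeGroup.conjAct L g (.of h) = .of (g * h * g⁻¹) := by
  simp [conjAct]

theorem SemidirectProduct.semiconjBy_inr {N H : Type*} [Group N] [Group H] {φ : H →* MulAut N}
    (a : H) (n : N) : SemiconjBy (inr a : N ⋊[φ] H) (inl n) (inl (φ a n)) := by
  rw [SemiconjBy, inl_aut, map_inv, inv_mul_cancel_right]

namespace MixedGraph

variable {V : Type*} {Γ : MixedGraph V}

theorem commute_gen {u v : V} (h : Γ.adj u v) (huv : (u, v) ∉ Γ.D) (hvu : (v, u) ∉ Γ.D) :
    Commute (Γ.gen u) (Γ.gen v) := by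
  have : Γ.gen u * Γ.gen v * (Γ.gen u)⁻¹ * (Γ.gen v)⁻¹ = 1 :=
    PresentedGroup.one_of_mem (rels := Γ.traagRels) (Or.inl ⟨u, v, h, huv, hvu, rfl⟩)
  rwa [mul_inv_eq_one, mul_inv_eq_iff_eq_mul] at this

theorem semiconjBy_gen {a b : V} (h : (a, b) ∈ Γ.D) :
    SemiconjBy (Γ.gen a) (Γ.gen b) (Γ.gen b)⁻¹ := by
  have : Γ.gen a * Γ.gen b * (Γ.gen a)⁻¹ * Γ.gen b = 1 :=
    PresentedGroup.one_of_mem (rels := Γ.traagRels) (Or.inr ⟨a, b, h, rfl⟩)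
  rwa [mul_eq_one_iff_eq_inv, mul_inv_eq_iff_eq_mul] at this

namespace TRAAG

variable {G : Type*} [Group G]

theorem hom_ext {f g : TRAAG Γ →* G} (h : ∀ v, f (Γ.gen v) = g (Γ.gen v)) : f = g :=
  PresentedGroup.ext (rels := Γ.traagRels) h

/-- The universal property of a TRAAG. -/
def lift (f : V → G)
    (hcomm : ∀ u v, Γ.adj u v → (u, v) ∉ Γ.D → (v, u) ∉ Γ.D → Commute (f u) (f v))
    (htwist : ∀ a b, (a, b) ∈ Γ.D → SemiconjBy (f a) (f b) (f b)⁻¹) : TRAAG Γ →* G :=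
  PresentedGroup.toGroup (rels := Γ.traagRels) (f := f) <| by
    rintro _ (⟨u, v, h, huv, hvu, rfl⟩ | ⟨a, b, h, rfl⟩)
    · simpa [mul_inv_eq_one, mul_inv_eq_iff_eq_mul] using (hcomm u v h huv hvu).eq
    · simpa [mul_eq_one_iff_eq_inv, mul_inv_eq_iff_eq_mul] using (htwist a b h).eq

@[simp]
theorem lift_gen (f : V → G)
    (hcomm : ∀ u v, Γ.adj u v → (u, v) ∉ Γ.D → (v, u) ∉ Γ.D → Commute (f u) (f v))
    (htwist : ∀ a b, (a, b) ∈ Γ.D → SemiconjBy (f a) (f b) (f b)⁻¹) (v : V) :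
    lift f hcomm htwist (Γ.gen v) = f v :=
  PresentedGroup.toGroup.of _

end TRAAG

open Classical in
theorem gen_ne_one (v : V) : Γ.gen v ≠ 1 := by
  intro h
  let s : Multiplicative (ZMod 2) := Multiplicative.ofAdd 1
  let f : TRAAG Γ →* Multiplicative (ZMod 2) := TRAAG.lift (fun u ↦ if u = v then s else 1)
    (fun _ _ _ _ _ ↦ Commute.all _ _) (fun a b _ ↦ by
      have : ∀ x : Multiplicative (ZMod 2), x = x⁻¹ := by decide
      exact (this _) ▸ Commute.all _ _)
  have : f (Γ.gen v) = s := by simp [f]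
  rw [h, map_one] at this
  revert this
  decide

/-- In a left-orderable group, `a b a⁻¹ = b⁻¹` forces `|b| < |a|`, so oriented cycles are
impossible. -/
theorem not_hasOrientedCycle_of_leftOrderable (h : LeftOrderable (TRAAG Γ)) :
    ¬ Γ.HasOrientedCycle := by
  classical
  rintro ⟨n, c, hD, hc⟩
  obtain ⟨P, h1, hmul, htot⟩ := h.exists_cone
  let m : TRAAG Γ → TRAAG Γ := fun x ↦ if x ∈ P then x else x⁻¹
  have hm : ∀ v, m (Γ.gen v) ∈ P := fun v ↦ by
    by_cases hv : Γ.gen v ∈ P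
    · simp [m, hv]
    · simpa [m, hv] using (htot _ (gen_ne_one v)).resolve_left hv
  have hlt : ∀ a b, (a, b) ∈ Γ.D → (m (Γ.gen b))⁻¹ * m (Γ.gen a) ∈ P := by
    intro a b hab
    have hs := semiconjBy_gen hab
    have : SemiconjBy (m (Γ.gen a)) (m (Γ.gen b)) (m (Γ.gen b))⁻¹ := by
      have hs' : SemiconjBy (m (Γ.gen a)) (Γ.gen b) (Γ.gen b)⁻¹ := by
        by_cases ha : Γ.gen a ∈ P
        · simpa only [m, if_pos ha] using hs
        · simpa only [m, if_neg ha, inv_inv] using hs.inv_symm_left.inv_right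
      by_cases hb : Γ.gen b ∈ P
      · simpa only [m, if_pos hb] using hs'
      · simpa only [m, if_neg hb] using hs'.inv_right
    rw [← this.eq]
    exact hmul _ (hm a) _ (hm b)
  let r : ZMod (n + 1) → ZMod (n + 1) → Prop := fun i j ↦
    (m (Γ.gen (c i).1))⁻¹ * m (Γ.gen (c j).1) ∈ P
  have : IsTrans _ r := ⟨fun i j k hij hjk ↦ by simpa [mul_assoc] using hmul _ hij _ hjk⟩
  have : Std.Irrefl r := ⟨fun i hi ↦ h1 (by simpa [r] using hi)⟩
  have hwf := Finite.wellFounded_of_trans_of_irrefl r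
  obtain ⟨i, -, hi⟩ := hwf.has_min Set.univ ⟨0, trivial⟩
  refine hi (i + 1) trivial ?_
  have := hlt _ _ (hD i)
  rwa [hc i] at this

theorem HasOrientedCycle.of_induce {U : Set V} (h : (Γ.induce U).HasOrientedCycle) :
    Γ.HasOrientedCycle := by
  obtain ⟨n, c, hD, hc⟩ := h
  exact ⟨n, fun i ↦ ((c i).1, (c i).2), hD, fun i ↦ congrArg Subtype.val (hc i)⟩

theorem exists_isSource [Finite V] [Nonempty V] (h : ¬ Γ.HasOrientedCycle) :
    ∃ v, Γ.IsSource v := by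
  by_contra! hs
  simp only [IsSource, not_forall, not_not] at hs
  choose f hf using hs
  obtain ⟨x, n, hx⟩ : ∃ x n, Function.IsPeriodicPt f (n + 1) x := by
    obtain ⟨k, l, hkl, heq⟩ :=
      Finite.exists_ne_map_eq_of_infinite fun k : ℕ ↦ f^[k] (Classical.arbitrary V)
    wlog hlt : k < l generalizing k l
    · exact this l k hkl.symm heq.symm (by omega)
    refine ⟨f^[k] (Classical.arbitrary V), l - k - 1, ?_⟩
    rw [Function.IsPeriodicPt, Function.IsFixedPt, ← Function.iterate_add_apply]
    convert heq.symm using 2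
    omega
  refine h ⟨n, fun i ↦ (f (f^[(-i).val] x), f^[(-i).val] x), fun i ↦ hf _, fun i ↦ ?_⟩
  simp only [← Function.iterate_succ_apply' f]
  rw [← hx.iterate_mod_apply ((-i).val), ← hx.iterate_mod_apply (Nat.succ _)]
  congr 1
  have : (((-i).val : ℕ) : ZMod (n + 1)) = (((-(i + 1)).val + 1 : ℕ) : ZMod (n + 1)) := by
    simp
  rw [(ZMod.natCast_eq_natCast_iff' _ _ _).1 this]

/-- The homomorphism induced by the inclusion of a full subgraph. -/
def induceHom (Γ : MixedGraph V) (U : Set V) : TRAAG (Γ.induce U) →* TRAAG Γ :=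
  TRAAG.lift (fun u ↦ Γ.gen u) (fun _ _ h h' h'' ↦ commute_gen h h' h'')
    (fun _ _ h ↦ semiconjBy_gen h)

@[simp]
theorem induceHom_gen (U : Set V) (u : U) :
    Γ.induceHom U ((Γ.induce U).gen u) = Γ.gen u :=
  TRAAG.lift_gen ..

/-- Left-orderability of a TRAAG is determined by finite full subgraphs. -/
theorem leftOrderable_of_finite_induce
    (h : ∀ U : Finset V, LeftOrderable (TRAAG (Γ.induce (U : Set V)))) :
    LeftOrderable (TRAAG Γ) := by
  classical
  let k : ∀ U : Finset V, FreeGroup V →* TRAAG (Γ.induce (U : Set V)) := fun U ↦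
    FreeGroup.lift fun v ↦ if hv : v ∈ U then (Γ.induce (U : Set V)).gen ⟨v, hv⟩ else 1
  have hk : ∀ (U : Finset V) {v} (hv : v ∈ U),
      k U (.of v) = (Γ.induce (U : Set V)).gen ⟨v, hv⟩ := fun U v hv ↦ by simp [k, hv]
  let f : FreeGroup V →* TRAAG Γ := PresentedGroup.mk Γ.traagRels
  have hfk : ∀ w, ∀ᶠ U : Finset V in Filter.atTop, Γ.induceHom U (k U w) = f w := by
    intro w
    induction w using FreeGroup.induction_on with
    | C1 => simp
    | of v =>
      filter_upwards [Filter.eventually_ge_atTop {v}] with U hU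
      rw [hk U (hU (Finset.mem_singleton_self v)), induceHom_gen]
      rfl
    | inv_of v hv =>
      filter_upwards [hv] with U hU
      rw [map_inv, map_inv, hU, map_inv]
    | mul x y hx hy =>
      filter_upwards [hx, hy] with U hx hy
      rw [map_mul, map_mul, hx, hy, map_mul]
  have hkf : ∀ w, f w = 1 → ∀ᶠ U : Finset V in Filter.atTop, k U w = 1 := by
    let N : Subgroup (FreeGroup V) :=
      { carrier := {w | ∀ᶠ U : Finset V in Filter.atTop, k U w = 1}
        one_mem' := by simp
        mul_mem' := fun {x y} hx hy ↦ by
          filter_upwards [hx, hy] with U hx hy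
          rw [map_mul, hx, hy, one_mul]
        inv_mem' := fun {x} hx ↦ by
          filter_upwards [hx] with U hx
          rw [map_inv, hx, inv_one] }
    have hN : N.Normal := ⟨fun x hx g ↦ by
      filter_upwards [hx] with U hx
      rw [map_mul, map_mul, hx, mul_one, map_inv, mul_inv_cancel]⟩
    have hle : Subgroup.normalClosure Γ.traagRels ≤ N := by
      refine Subgroup.normalClosure_le_normal ?_
      rintro _ (⟨u, v, h, huv, hvu, rfl⟩ | ⟨u, v, h, rfl⟩) <;>
      · filter_upwards [Filter.eventually_ge_atTop {u, v}] with U hU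
        have hu : u ∈ U := hU (by simp)
        have hv : v ∈ U := hU (by simp)
        simp only [map_mul, map_inv, hk U hu, hk U hv]
        first
        | rw [mul_inv_eq_one, mul_inv_eq_iff_eq_mul]
          exact commute_gen (Γ := Γ.induce (U : Set V)) h huv hvu
        | rw [mul_eq_one_iff_eq_inv, mul_inv_eq_iff_eq_mul]
          exact semiconjBy_gen (Γ := Γ.induce (U : Set V)) h
    exact fun w hw ↦ hle (PresentedGroup.mk_eq_one_iff.1 hw)
  let A : Ultrafilter (Finset V) := Ultrafilter.of Filter.atTop
  have hA : (A : Filter (Finset V)) ≤ Filter.atTop := Ultrafilter.of_le _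
  refine .of_ultrafilter A h f (PresentedGroup.mk_surjective _) k fun w ↦
    ⟨fun hw ↦ hA (hkf w hw), fun hw ↦ ?_⟩
  obtain ⟨U, hU, hU'⟩ := (hw.and (hA (hfk w))).exists
  rw [← hU', hU, map_one]

open Classical in
/-- The automorphism of a TRAAG inverting the generators in `T` and fixing the others. -/
noncomputable def flip (Γ : MixedGraph V) (T : Set V) : MulAut (TRAAG Γ) :=
  let f : TRAAG Γ →* TRAAG Γ := TRAAG.lift (fun u ↦ if u ∈ T then (Γ.gen u)⁻¹ else Γ.gen u)
    (fun u v h huv hvu ↦ by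
      have := commute_gen h huv hvu
      split_ifs <;> simpa)
    (fun a b h ↦ by
      have := semiconjBy_gen h
      have := this.inv_symm_left.inv_right
      split_ifs <;> simpa)
  have hf : f.comp f = MonoidHom.id _ := TRAAG.hom_ext fun v ↦ by
    by_cases hv : v ∈ T <;> simp [f, hv]
  f.toMulEquiv f hf hf

theorem flip_gen_of_mem {T : Set V} {v : V} (h : v ∈ T) : Γ.flip T (Γ.gen v) = (Γ.gen v)⁻¹ := by
  simp [flip, h]

theorem flip_gen_of_notMem {T : Set V} {v : V} (h : v ∉ T) : Γ.flip T (Γ.gen v) = Γ.gen v := by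
  simp [flip, h]

theorem induceHom_flip (U T : Set V) (x : TRAAG (Γ.induce U)) :
    Γ.induceHom U ((Γ.induce U).flip (Subtype.val ⁻¹' T) x) = Γ.flip T (Γ.induceHom U x) := by
  suffices (Γ.induceHom U).comp ((Γ.induce U).flip (Subtype.val ⁻¹' T)).toMonoidHom =
      (Γ.flip T).toMonoidHom.comp (Γ.induceHom U) from DFunLike.congr_fun this x
  refine TRAAG.hom_ext fun v ↦ ?_
  by_cases hv : v.1 ∈ T
  · have hv' : v ∈ Subtype.val ⁻¹' T := hv
    simp [flip_gen_of_mem hv, flip_gen_of_mem hv']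
  · have hv' : v ∉ Subtype.val ⁻¹' T := hv
    simp [flip_gen_of_notMem hv', flip_gen_of_notMem hv]

/-- Removing a source preserves hereditary indicability. -/
theorem hereditarilyIndicable_of_isSource {v : V} (hv : Γ.IsSource v)
    (h : HereditarilyIndicable (TRAAG (Γ.induce {v}ᶜ))) : HereditarilyIndicable (TRAAG Γ) := by
  classical
  let T : Set V := {u | (v, u) ∈ Γ.D}
  let T' : Set ({v}ᶜ : Set V) := Subtype.val ⁻¹' T
  let α := zpowersHom (MulAut (TRAAG Γ)) (Γ.flip T)
  let β := zpowersHom (MulAut (TRAAG (Γ.induce {v}ᶜ))) ((Γ.induce {v}ᶜ).flip T')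
  let ψ : TRAAG (Γ.induce {v}ᶜ) ⋊[β] Multiplicative ℤ →* TRAAG Γ ⋊[α] Multiplicative ℤ :=
    SemidirectProduct.map (Γ.induceHom {v}ᶜ) (MonoidHom.id _) fun n ↦
      MonoidHom.ext fun x ↦ map_mulAut_zpow (induceHom_flip {v}ᶜ T) n.toAdd x
  let t : Multiplicative ℤ := Multiplicative.ofAdd 1
  have hα : α t = Γ.flip T := by simp [α, t]
  have hβ : β t = (Γ.induce {v}ᶜ).flip T' := by simp [β, t]
  let y : TRAAG Γ ⋊[α] Multiplicative ℤ := .inl (Γ.gen v) * (.inr t)⁻¹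
  let γ := (FreeGroup.conjAct (TRAAG Γ ⋊[α] Multiplicative ℤ)).comp ψ
  let p := SemidirectProduct.lift (φ := γ) (FreeGroup.lift id) ψ fun g ↦
    FreeGroup.ext_hom _ _ fun a ↦ by simp [γ]
  -- `s` plays the role of the stable letter, acting as conjugation by `v` up to `x`
  let x := SemidirectProduct.inl (φ := γ) (.of y)
  let s := SemidirectProduct.inr (φ := γ) (.inr t)
  let g : ({v}ᶜ : Set V) → _ := fun u ↦
    SemidirectProduct.inr (φ := γ) (.inl ((Γ.induce {v}ᶜ).gen u))
  have hD : ∀ u ∈ T, SemiconjBy (.inr t : TRAAG Γ ⋊[α] _) (.inl (Γ.gen u)) (.inl (Γ.gen u))⁻¹ :=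
    fun u hu ↦ by
      simpa [hα, flip_gen_of_mem hu] using SemidirectProduct.semiconjBy_inr (φ := α) t (Γ.gen u)
  have hD' : ∀ u ∉ T, Commute (.inr t : TRAAG Γ ⋊[α] _) (.inl (Γ.gen u)) := fun u hu ↦ by
    have := SemidirectProduct.semiconjBy_inr (φ := α) t (Γ.gen u)
    rwa [hα, flip_gen_of_notMem hu] at this
  have hy : ∀ u, Γ.adj v u → Commute y (.inl (Γ.gen u)) := by
    intro u hu
    by_cases huT : u ∈ T
    · have := (semiconjBy_gen huT).inv_right.map (SemidirectProduct.inl (φ := α))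
      rw [inv_inv, map_inv] at this
      exact this.mul_left (hD u huT).inv_symm_left.inv_right
    · exact ((commute_gen hu huT (hv u)).map SemidirectProduct.inl).mul_left (hD' u huT).inv_left
  have hxg : ∀ u : ({v}ᶜ : Set V), Γ.adj v u → Commute x (g u) := by
    intro u hu
    have := SemidirectProduct.semiconjBy_inr (φ := γ) (.inl ((Γ.induce {v}ᶜ).gen u)) (.of y)
    have hfix : γ (.inl ((Γ.induce {v}ᶜ).gen u)) (.of y) = .of y := by
      simp [γ, ψ, (hy u hu).symm.eq]
    rw [hfix] at this
    exact this.symm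
  have hsg : ∀ u : ({v}ᶜ : Set V), u.1 ∈ T → SemiconjBy s (g u) (g u)⁻¹ := by
    intro u hu
    have := (SemidirectProduct.semiconjBy_inr (φ := β) t ((Γ.induce {v}ᶜ).gen u)).map
      (SemidirectProduct.inr (φ := γ))
    rwa [hβ, flip_gen_of_mem (show u ∈ T' from hu), map_inv, map_inv] at this
  have hsg' : ∀ u : ({v}ᶜ : Set V), u.1 ∉ T → Commute s (g u) := by
    intro u hu
    have := (SemidirectProduct.semiconjBy_inr (φ := β) t ((Γ.induce {v}ᶜ).gen u)).map
      (SemidirectProduct.inr (φ := γ))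
    rwa [hβ, flip_gen_of_notMem (show u ∉ T' from hu)] at this
  let ι := (SemidirectProduct.inr (φ := γ)).comp (SemidirectProduct.inl (φ := β))
  let F : V → FreeGroup _ ⋊[γ] _ := fun u ↦ if hu : u = v then x * s else g ⟨u, hu⟩
  have hFv : F v = x * s := dif_pos rfl
  have hF : ∀ u (hu : u ≠ v), F u = g ⟨u, hu⟩ := fun u hu ↦ dif_neg hu
  have hcomm : ∀ u, Γ.adj v u → u ∉ T → Commute (F v) (F u) := by
    intro u hu huT
    have hne : u ≠ v := fun h ↦ Γ.loopless v (h ▸ hu)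
    rw [hFv, hF u hne]
    exact (hxg ⟨u, hne⟩ hu).mul_left (hsg' ⟨u, hne⟩ huT)
  let j : TRAAG Γ →* FreeGroup _ ⋊[γ] _ := TRAAG.lift F
    (fun u w he huw hwu ↦ by
      rcases eq_or_ne u v with rfl | hu
      · exact hcomm w he huw
      rcases eq_or_ne w v with rfl | hw
      · exact (hcomm u (Γ.symm _ _ he) hwu).symm
      rw [hF u hu, hF w hw]
      exact (commute_gen (Γ := Γ.induce {v}ᶜ) (u := ⟨u, hu⟩) (v := ⟨w, hw⟩) he huw hwu).map ι)
    (fun a b he ↦ by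
      have hb : b ≠ v := fun hb ↦ hv a (hb ▸ he)
      rcases eq_or_ne a v with rfl | ha
      · rw [hFv, hF b hb]
        exact SemiconjBy.mul_left (hxg ⟨b, hb⟩ (Γ.D_isEdge (a, b) he)).inv_right (hsg ⟨b, hb⟩ he)
      · rw [hF a ha, hF b hb]
        have := (semiconjBy_gen (Γ := Γ.induce {v}ᶜ) (a := ⟨a, ha⟩) (b := ⟨b, hb⟩) he).map ι
        rwa [map_inv] at this)
  have hpj : p.comp j = SemidirectProduct.inl := by
    refine TRAAG.hom_ext fun u ↦ ?_
    by_cases hu : u = v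
    · subst hu
      simp [p, j, hFv, x, s, y, ψ]
    · simp [p, j, hF u hu, g, ψ]
  refine .of_injective j ?_ ((HereditarilyIndicable.freeGroup _).semidirectProduct γ
    (h.semidirectProduct β .multiplicative_int))
  refine Function.Injective.of_comp (f := p) ?_
  rw [← MonoidHom.coe_comp, hpj]
  exact SemidirectProduct.inl_injective

theorem hereditarilyIndicable_of_finite {V : Type*} [Finite V] (Γ : MixedGraph V)
    (h : ¬ Γ.HasOrientedCycle) : HereditarilyIndicable (TRAAG Γ) := by
  induction hn : Nat.card V generalizing V with
  | zero =>
    have : IsEmpty V := (Finite.card_eq_zero_iff).1 hn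
    have : Subsingleton (TRAAG Γ) := subsingleton_of_forall_eq 1 fun x ↦ by
      have : MonoidHom.id (TRAAG Γ) = 1 := TRAAG.hom_ext isEmptyElim
      exact DFunLike.congr_fun this x
    exact .of_subsingleton
  | succ n ih =>
    have : Nonempty V := (Nat.card_pos_iff.1 (by omega)).1
    obtain ⟨v, hv⟩ := exists_isSource h
    refine hereditarilyIndicable_of_isSource hv (ih _ (fun h' ↦ h h'.of_induce) ?_)
    have := Set.ncard_add_ncard_compl {v}
    rw [Set.ncard_singleton] at this
    change Set.ncard _ = _
    omega

end MixedGraph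

open MixedGraph in
/-- The TRAAG of a mixed graph `Γ` is left-orderable if and only if `Γ` contains no
oriented cycle. -/
theorem TRAAG.leftOrderable_iff_no_orientedCycle {V : Type} (Γ : MixedGraph V) :
    LeftOrderable (TRAAG Γ) ↔ ¬ Γ.HasOrientedCycle := by
  refine ⟨not_hasOrientedCycle_of_leftOrderable, fun h ↦ ?_⟩
  refine leftOrderable_of_finite_induce fun U ↦ HereditarilyIndicable.leftOrderable ?_
  exact hereditarilyIndicable_of_finite _ fun h' ↦ h h'.of_induce
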